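/- For every d with 1 ≤ d ≤ n, binomial(2d, d) = Σ_{e | d} e·h(e), where h(e) denotes the number of e-cycles in the graph G(n, 312) and the sum is over all positive divisors e of d. -/

import Mathlib

/-- A permutation avoids the pattern 312 if there are no indices
`i < j < k` with `π j < π k < π i`. -/
def Avoids312 {m : ℕ} (π : Equiv.Perm (Fin m)) : Prop :=
  ¬ ∃ i j k : Fin m, i < j ∧ j < k ∧ π j < π k ∧ π k < π i

/-- An edge of the graph `G(n, 312)` of overlapping 312-avoiding permutations:
a 312-avoiding permutation `σ ∈ S_{n+1}`; its tail is `Π(σ_1 ⋯ σ_n)` and its head is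
`Π(σ_2 ⋯ σ_{n+1})` (standardizations of the first resp. last `n` letters). -/
def Edge (n : ℕ) : Type := {σ : Equiv.Perm (Fin (n + 1)) // Avoids312 σ}

/-- `head σ = tail τ` in `G(n, 312)`: the standardization of the last `n` letters of `σ`
equals the standardization of the first `n` letters of `τ`, i.e. the last `n` letters of
`σ` and the first `n` letters of `τ` are in the same relative order. -/
def HeadEqTail {n : ℕ} (σ τ : Edge n) : Prop :=
  ∀ a b : Fin n, (σ.1 a.succ < σ.1 b.succ ↔ τ.1 a.castSucc < τ.1 b.castSucc)

/-- A closed walk of length `e` in `G(n, 312)`: a cyclic list `(e_1, …, e_e)` of edges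
with `head (e_i) = tail (e_{i+1})` (indices mod `e`). -/
def ClosedWalk (n e : ℕ) : Type :=
  {w : ZMod e → Edge n // ∀ i : ZMod e, HeadEqTail (w i) (w (i + 1))}

/-- The equivalence class of a closed walk under cyclic shifts. -/
def walkClass {n e : ℕ} (w : ClosedWalk n e) : Set (ClosedWalk n e) :=
  {w' | ∃ c : ZMod e, ∀ i : ZMod e, w'.1 i = w.1 (i + c)}

/-- `numCycles n e` is the number of `e`-cycles in `G(n, 312)`: equivalence classes, of
size exactly `e`, of closed walks of length `e` under cyclic shifts. -/
noncomputable def numCycles (n e : ℕ) : ℕ :=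
  Nat.card {S : Set (ClosedWalk n e) //
    (∃ w : ClosedWalk n e, S = walkClass w) ∧ S.ncard = e}


namespace CB

def Q {d : ℕ} (a : ZMod d → ℕ → Prop) (y : ZMod d) (u : ℕ) : Prop :=
  1 ≤ u ∧ ¬ a y u ∧ ∀ s, 1 ≤ s → s < u → a y s

open Classical in
noncomputable def cOf {d : ℕ} (n : ℕ) (a : ZMod d → ℕ → Prop) (k : ZMod d) : ℕ :=
  ((Finset.Icc 1 n).filter (fun u : ℕ => Q a (k - (u : ZMod d)) u)).card

def G {d : ℕ} (c : ZMod d → ℕ) (j : ZMod d) (t : ℕ) : ℤ :=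
  ∑ m ∈ Finset.range t, (1 - (c (j + (m : ZMod d) + 1) : ℤ))

def AF {d : ℕ} (c : ZMod d → ℕ) (j : ZMod d) (t : ℕ) : Prop :=
  ∃ s, s < t ∧ G c j s < G c j t

structure Valid {d : ℕ} (n : ℕ) (a : ZMod d → ℕ → Prop) : Prop where
  h13 : ∀ (j : ZMod d) (s u : ℕ), 1 ≤ s → 1 ≤ u → s + u ≤ n → a (j + (s : ZMod d)) u → a j (s + u)
  h2 : ∀ (j : ZMod d) (s u : ℕ), 1 ≤ s → 1 ≤ u → s + u ≤ n → ¬ a j s → ¬ a (j + (s : ZMod d)) u →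
    ¬ a j (s + u)

lemma G_add {d : ℕ} (c : ZMod d → ℕ) (j : ZMod d) (s u : ℕ) :
    G c j (s + u) = G c j s + G c (j + (s : ZMod d)) u := by
  unfold G
  rw [Finset.sum_range_add]
  congr 1
  apply Finset.sum_congr rfl
  intro m _
  rw [Nat.cast_add, ← add_assoc j]

lemma AF_valid {d : ℕ} (n : ℕ) (c : ZMod d → ℕ) : Valid n (AF c) := by
  constructor
  · rintro j s u hs hu - ⟨x, hx, h⟩
    refine ⟨s + x, by omega, ?_⟩
    rw [G_add, G_add]; omega
  · rintro j s u hs hu - h1 h2 ⟨x, hx, h⟩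
    unfold AF at h1 h2
    push Not at h1 h2
    have h20 := h2 0 (by omega)
    rw [G_add] at h
    have : G c (j + (s : ZMod d)) 0 = 0 := by simp [G]
    by_cases hxs : x < s
    · have := h1 x hxs
      omega
    · obtain ⟨y, rfl⟩ := Nat.exists_eq_add_of_le (not_lt.1 hxs)
      have := h2 y (by omega)
      rw [G_add] at h
      omega

lemma Q_unique {d : ℕ} (a : ZMod d → ℕ → Prop) (y : ZMod d) (u v : ℕ) (h : Q a y u) (h' : Q a y v) :
    u = v := by
  rcases lt_trichotomy u v with h1 | h1 | h1
  · exact absurd (h'.2.2 u h.1 h1) h.2.1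
  · exact h1
  · exact absurd (h.2.2 v h'.1 h1) h'.2.1

lemma Q_exists {d : ℕ} (a : ZMod d → ℕ → Prop) (y : ZMod d) (t : ℕ) (ht : 1 ≤ t) (h : ¬ a y t) :
    ∃ u, u ≤ t ∧ Q a y u := by
  classical
  have hex : ∃ u, 1 ≤ u ∧ ¬ a y u := ⟨t, ht, h⟩
  refine ⟨Nat.find hex, Nat.find_min' hex ⟨ht, h⟩, (Nat.find_spec hex).1, (Nat.find_spec hex).2, ?_⟩
  intro s hs hlt
  by_contra hc
  exact Nat.find_min hex hlt ⟨hs, hc⟩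

lemma sum_cOf_le {d : ℕ} [NeZero d] (n : ℕ) (a : ZMod d → ℕ → Prop) : ∑ k, cOf n a k ≤ d := by
  classical
  unfold cOf
  simp_rw [Finset.card_filter]
  rw [Finset.sum_comm]
  have : ∀ u ∈ Finset.Icc 1 n, (∑ k : ZMod d, if Q a (k - (u : ZMod d)) u then 1 else 0)
      = ∑ k : ZMod d, if Q a k u then 1 else 0 := by
    intro u _
    exact Equiv.sum_comp (Equiv.subRight (u : ZMod d)) (fun k => if Q a k u then 1 else 0)
  rw [Finset.sum_congr rfl this, Finset.sum_comm]
  calc _ ≤ ∑ k : ZMod d, 1 := by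
        apply Finset.sum_le_sum
        intro k _
        rw [← Finset.card_filter, Finset.card_le_one]
        intro x hx y hy
        exact Q_unique a k x y (Finset.mem_filter.1 hx).2 (Finset.mem_filter.1 hy).2
    _ = d := by simp [ZMod.card]

lemma G_eq {d : ℕ} (c : ZMod d → ℕ) (j : ZMod d) (t : ℕ) :
    G c j t = t - ∑ m ∈ Finset.range t, (c (j + (m : ZMod d) + 1) : ℤ) := by
  simp [G]

/-- part (a) -/
lemma G_nonpos {d n : ℕ} (a : ZMod d → ℕ → Prop) (ha : Valid n a) (j : ZMod d) (t : ℕ) (ht : 1 ≤ t)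
    (htn : t ≤ n) (h : ¬ a j t) : G (cOf n a) j t ≤ 0 := by
  classical
  rw [G_eq]
  have key : t ≤ ∑ m ∈ Finset.range t, cOf n a (j + (m : ZMod d) + 1) := by
    calc t = ∑ x ∈ Finset.range t, 1 := by simp
      _ ≤ ∑ x ∈ Finset.range t, ∑ m ∈ Finset.range t,
          (if x ≤ m ∧ Q a (j + (x : ZMod d)) (m + 1 - x) then 1 else 0) := by
        apply Finset.sum_le_sum
        intro x hx
        rw [Finset.mem_range] at hx
        have h' : ¬ a (j + (x : ZMod d)) (t - x) := by
          rcases Nat.eq_zero_or_pos x with rfl | hx0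
          · simpa using h
          · intro hc
            have := ha.h13 j x (t - x) hx0 (by omega) (by omega) hc
            rw [Nat.add_sub_cancel' hx.le] at this
            exact h this
        obtain ⟨u, hu, hQ⟩ := Q_exists a _ (t - x) (by omega) h'
        have h1 := hQ.1
        rw [← Finset.card_filter, Nat.one_le_iff_ne_zero, Finset.card_ne_zero]
        refine ⟨x + u - 1, Finset.mem_filter.2 ⟨Finset.mem_range.2 (by omega), by omega, ?_⟩⟩
        have : x + u - 1 + 1 - x = u := by omega
        rwa [this]
      _ = ∑ m ∈ Finset.range t, ∑ x ∈ Finset.range t,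
          (if x ≤ m ∧ Q a (j + (x : ZMod d)) (m + 1 - x) then 1 else 0) := Finset.sum_comm
      _ ≤ _ := by
        apply Finset.sum_le_sum
        intro m hm
        rw [Finset.mem_range] at hm
        rw [← Finset.card_filter]
        unfold cOf
        apply Finset.card_le_card_of_injOn (fun x => m + 1 - x)
        · intro x hx
          simp only [Finset.coe_filter, Finset.mem_range, Set.mem_ofPred_eq] at hx
          simp only [Finset.coe_filter, Finset.mem_Icc, Set.mem_ofPred_eq]
          refine ⟨by omega, ?_⟩
          have : j + (m : ZMod d) + 1 - ((m + 1 - x : ℕ) : ZMod d) = j + x := by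
            rw [Nat.cast_sub (by omega)]; push_cast; ring
          rw [this]; exact hx.2.2
        · intro x hx y hy hxy
          simp only [Finset.coe_filter, Finset.mem_range, Set.mem_ofPred_eq] at hx hy
          simp only at hxy
          omega
  have : (t : ℤ) ≤ ∑ m ∈ Finset.range t, (cOf n a (j + (m : ZMod d) + 1) : ℤ) := by exact_mod_cast key
  omega

/-- part (b) -/
lemma G_pos {d n : ℕ} (a : ZMod d → ℕ → Prop) (ha : Valid n a) (j : ZMod d) (t : ℕ) (ht : 1 ≤ t)
    (htn : t ≤ n) (h : a j t) (hmax : ∀ x, 1 ≤ x → x < t → ¬ a (j + (x : ZMod d)) (t - x)) :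
    0 < G (cOf n a) j t := by
  classical
  rw [G_eq]
  have key : ∑ m ∈ Finset.range t, cOf n a (j + (m : ZMod d) + 1) ≤ t - 1 := by
    calc ∑ m ∈ Finset.range t, cOf n a (j + (m : ZMod d) + 1)
      _ ≤ ∑ m ∈ Finset.range t, ∑ x ∈ Finset.Ico 1 t,
          (if x ≤ m ∧ Q a (j + (x : ZMod d)) (m + 1 - x) then 1 else 0) := by
        apply Finset.sum_le_sum
        intro m hm
        rw [Finset.mem_range] at hm
        rw [← Finset.card_filter]
        unfold cOf
        have hlt : ∀ u, 1 ≤ u → u ≤ n → Q a (j + (m : ZMod d) + 1 - (u : ZMod d)) u → u ≤ m := by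
          intro u hu1 hun hQ
          by_contra hc
          have h1 : ¬ a j (m + 1) := by
            rcases Nat.lt_or_ge (m + 1) u with h2 | h2
            · intro h3
              apply hQ.2.1
              have h4 := ha.h13 (j + (m : ZMod d) + 1 - (u : ZMod d)) (u - (m + 1)) (m + 1) (by omega) (by omega)
                (by omega)
              have h5 : j + (m : ZMod d) + 1 - (u : ZMod d) + ((u - (m + 1) : ℕ) : ZMod d) = j := by
                rw [Nat.cast_sub (by omega)]; push_cast; ring
              rw [h5] at h4
              have h6 := h4 h3
              rwa [Nat.sub_add_cancel (by omega)] at h6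
            · have : u = m + 1 := by omega
              subst this
              have := hQ.2.1
              have h5 : j + (m : ZMod d) + 1 - ((m + 1 : ℕ) : ZMod d) = j := by push_cast; ring
              rwa [h5] at this
          rcases Nat.lt_or_ge (m + 1) t with h2 | h2
          · have h3 := ha.h2 j (m + 1) (t - (m + 1)) (by omega) (by omega) (by omega) h1
              (hmax (m + 1) (by omega) h2)
            rw [Nat.add_sub_cancel' h2.le] at h3
            exact h3 h
          · have : m + 1 = t := by omega
            rw [this] at h1
            exact h1 h
        apply Finset.card_le_card_of_injOn (fun u => m + 1 - u)
        · intro u hu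
          simp only [Finset.coe_filter, Finset.mem_Icc, Set.mem_ofPred_eq] at hu
          simp only [Finset.coe_filter, Finset.mem_Ico, Set.mem_ofPred_eq]
          have := hlt u hu.1.1 hu.1.2 hu.2
          refine ⟨by omega, by omega, ?_⟩
          have h5 : j + ((m + 1 - u : ℕ) : ZMod d) = j + (m : ZMod d) + 1 - (u : ZMod d) := by
            rw [Nat.cast_sub (by omega)]; push_cast; ring
          rw [h5, show m + 1 - (m + 1 - u) = u by omega]
          exact hu.2
        · intro x hx y hy hxy
          simp only [Finset.coe_filter, Finset.mem_Icc, Set.mem_ofPred_eq] at hx hy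
          have := hlt x hx.1.1 hx.1.2 hx.2
          have := hlt y hy.1.1 hy.1.2 hy.2
          simp only at hxy
          omega
      _ = ∑ x ∈ Finset.Ico 1 t, ∑ m ∈ Finset.range t,
          (if x ≤ m ∧ Q a (j + (x : ZMod d)) (m + 1 - x) then 1 else 0) := Finset.sum_comm
      _ ≤ ∑ x ∈ Finset.Ico 1 t, 1 := by
        apply Finset.sum_le_sum
        intro x hx
        rw [← Finset.card_filter, Finset.card_le_one]
        intro p hp q hq
        simp only [Finset.mem_filter] at hp hq
        have := Q_unique a _ _ _ hp.2.2 hq.2.2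
        omega
      _ = t - 1 := by simp
  have : ∑ m ∈ Finset.range t, (cOf n a (j + (m : ZMod d) + 1) : ℤ) ≤ ((t - 1 : ℕ) : ℤ) := by
    exact_mod_cast key
  omega

lemma a_iff {d n : ℕ} (a : ZMod d → ℕ → Prop) (ha : Valid n a) (j : ZMod d) (t : ℕ) (ht : 1 ≤ t)
    (htn : t ≤ n) : a j t ↔ AF (cOf n a) j t := by
  classical
  constructor
  · intro h
    let p : ℕ → Prop := fun i => i < t ∧ a (j + (i : ZMod d)) (t - i)
    have h0 : p 0 := ⟨ht, by simpa using h⟩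
    obtain ⟨i, hi, hm⟩ : ∃ i, p i ∧ ∀ x, i < x → ¬ p x := by
      refine ⟨Nat.findGreatest p t, Nat.findGreatest_spec (Nat.zero_le t) h0, ?_⟩
      intro x hx hp
      exact Nat.findGreatest_is_greatest hx hp.1.le hp
    refine ⟨i, hi.1, ?_⟩
    have := G_pos a ha (j + (i : ZMod d)) (t - i) (by have := hi.1; omega) (by omega) hi.2 (by
      intro x hx1 hx2 hc
      apply hm (i + x) (by omega)
      refine ⟨by omega, ?_⟩
      push_cast
      rw [← add_assoc, ← Nat.sub_sub]
      exact hc)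
    have h2 := G_add (cOf n a) j i (t - i)
    rw [Nat.add_sub_cancel' hi.1.le] at h2
    omega
  · rintro ⟨s, hs, hG⟩
    by_contra hc
    have h2 := G_add (cOf n a) j s (t - s)
    rw [Nat.add_sub_cancel' hs.le] at h2
    have := G_nonpos a ha (j + (s : ZMod d)) (t - s) (by omega) (by omega) (by
      rcases Nat.eq_zero_or_pos s with rfl | hx0
      · simpa using hc
      · intro hc'
        have := ha.h13 j s (t - s) hx0 (by omega) (by omega) hc'
        rw [Nat.add_sub_cancel' hs.le] at this
        exact hc this)
    omega

lemma Q_AF {d : ℕ} (c : ZMod d → ℕ) (y : ZMod d) (u : ℕ) :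
    Q (AF c) y u ↔ 1 ≤ u ∧ G c y u ≤ 0 ∧ ∀ s, 1 ≤ s → s < u → 0 < G c y s := by
  have hG0 : G c y 0 = 0 := by simp [G]
  constructor
  · rintro ⟨h1, h2, h3⟩
    unfold AF at h2
    push Not at h2
    refine ⟨h1, by have := h2 0 h1; omega, ?_⟩
    intro s
    induction s using Nat.strong_induction_on with
    | _ s ih =>
      intro hs hsu
      obtain ⟨x, hx, h⟩ := h3 s hs hsu
      rcases Nat.eq_zero_or_pos x with rfl | hx0
      · omega
      · have := ih x hx hx0 (by omega)
        omega
  · rintro ⟨h1, h2, h3⟩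
    refine ⟨h1, ?_, ?_⟩
    · rintro ⟨s, hs, h⟩
      rcases Nat.eq_zero_or_pos s with rfl | hx0
      · omega
      · have := h3 s hx0 hs
        omega
    · intro s hs hsu
      exact ⟨0, hs, by have := h3 s hs hsu; omega⟩

lemma G_period {d : ℕ} [NeZero d] (c : ZMod d → ℕ) (y : ZMod d) :
    G c y d = d - ∑ k, (c k : ℤ) := by
  rw [G_eq]
  congr 1
  refine Finset.sum_bij (fun m _ => y + (m : ZMod d) + 1) (by simp) ?_ ?_ (by simp)
  · intro m hm m' hm' h
    simp only [add_left_inj, add_right_inj] at h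
    rw [Finset.mem_range] at hm hm'
    have := congrArg ZMod.val h
    rwa [ZMod.val_natCast_of_lt hm, ZMod.val_natCast_of_lt hm'] at this
  · intro b _
    refine ⟨(b - y - 1).val, Finset.mem_range.2 (ZMod.val_lt _), ?_⟩
    simp only [ZMod.natCast_val, ZMod.cast_id', id_eq]
    ring

lemma cOf_AF {d n : ℕ} [NeZero d] (hdn : d ≤ n) (c : ZMod d → ℕ) (hc : ∑ k, c k ≤ d) :
    cOf n (AF c) = c := by
  classical
  funext k
  obtain ⟨H, hH⟩ : ∃ H : ℕ → ℤ, ∀ u, H u = G c (k - (u : ZMod d)) u := ⟨_, fun _ => rfl⟩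
  have hd : 1 ≤ d := Nat.one_le_iff_ne_zero.2 (NeZero.ne d)
  have hrel : ∀ s u, H (s + u) = G c (k - ((s + u : ℕ) : ZMod d)) s + H u := by
    intro s u
    rw [hH, hH, G_add]
    congr 2
    push_cast; ring
  have H0 : H 0 = 0 := by simp [hH, G]
  have H1 : H 1 = 1 - c k := by simp [hH, G]
  have Hd : 0 ≤ H d := by
    rw [hH, G_period]
    have : ∑ k, (c k : ℤ) ≤ d := by exact_mod_cast hc
    omega
  have Hs : ∀ u, H (u + 1) ≤ H u + 1 := by
    intro u
    have := hrel 1 u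
    rw [add_comm 1 u] at this
    rw [this]
    simp [G]
    omega
  have hQ : ∀ u : ℕ, Q (AF c) (k - (u : ZMod d)) u ↔ 1 ≤ u ∧ H u ≤ 0 ∧ ∀ s, 1 ≤ s → s < u → H s < H u := by
    intro u
    rw [Q_AF, ← hH]
    refine and_congr_right fun h1 => and_congr_right fun h2 => ?_
    constructor
    · intro h s hs hsu
      have h3 := h (u - s) (by omega) (by omega)
      have := hrel (u - s) s
      rw [Nat.sub_add_cancel hsu.le] at this
      omega
    · intro h s hs hsu
      have h3 := h (u - s) (by omega) (by omega)
      have := hrel s (u - s)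
      rw [Nat.add_sub_cancel' hsu.le] at this
      omega
  have hcard : ((Finset.Icc 1 n).filter (fun u : ℕ => Q (AF c) (k - (u : ZMod d)) u)).card
      = (Finset.Icc (1 - (c k : ℤ)) 0).card := by
    refine Finset.card_bij (fun u _ => H u) ?_ ?_ ?_
    · intro u hu
      simp only [Finset.mem_filter, hQ, Finset.mem_Icc] at hu ⊢
      refine ⟨?_, hu.2.2.1⟩
      rcases Nat.lt_or_ge 1 u with h | h
      · have := hu.2.2.2 1 le_rfl h
        omega
      · have : u = 1 := by omega
        subst this
        omega
    · intro u hu v hv h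
      simp only [Finset.mem_filter, hQ, Finset.mem_Icc] at hu hv
      rcases lt_trichotomy u v with h1 | h1 | h1
      · have := hv.2.2.2 u hu.1.1 h1
        omega
      · exact h1
      · have := hu.2.2.2 v hv.1.1 h1
        omega
    · intro v hv
      rw [Finset.mem_Icc] at hv
      have hex : ∃ u, 1 ≤ u ∧ v ≤ H u := ⟨d, hd, by omega⟩
      obtain ⟨u, hu, hmin, hud⟩ : ∃ u, (1 ≤ u ∧ v ≤ H u) ∧ (∀ s, s < u → ¬ (1 ≤ s ∧ v ≤ H s)) ∧ u ≤ d :=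
        ⟨Nat.find hex, Nat.find_spec hex, fun s hs => Nat.find_min hex hs,
          Nat.find_min' hex ⟨hd, by omega⟩⟩
      have hv' : H u = v := by
        rcases Nat.lt_or_ge 1 u with h | h
        · have h1 := hmin (u - 1) (by omega)
          have h2 := Hs (u - 1)
          rw [Nat.sub_add_cancel hu.1] at h2
          have h3 : ¬ v ≤ H (u - 1) := fun h4 => h1 ⟨by omega, h4⟩
          omega
        · have : u = 1 := by omega
          subst this
          omega
      refine ⟨u, ?_, hv'⟩
      simp only [Finset.mem_filter, hQ, Finset.mem_Icc]
      refine ⟨⟨hu.1, by omega⟩, hu.1, by omega, ?_⟩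
      intro s hs hsu
      have h3 : ¬ v ≤ H s := fun h4 => hmin s hsu ⟨hs, h4⟩
      omega
  unfold cOf
  convert hcard using 1
  simp

lemma card_c (d : ℕ) [NeZero d] :
    Nat.card {c : ZMod d → ℕ // ∑ k, c k ≤ d} = (2 * d).choose d := by
  have e : {c : ZMod d → ℕ // ∑ k, c k ≤ d} ≃ {P : Option (ZMod d) → ℕ // ∑ i, P i = d} :=
    { toFun := fun c => ⟨fun o => o.elim (d - ∑ k, c.1 k) c.1, by
        rw [Fintype.sum_option]; simpa using Nat.sub_add_cancel c.2⟩
      invFun := fun P => ⟨fun k => P.1 (some k), by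
        have := P.2; rw [Fintype.sum_option] at this; dsimp only; omega⟩
      left_inv := fun c => by ext; rfl
      right_inv := fun P => by
        ext o
        have := P.2; rw [Fintype.sum_option] at this
        cases o with
        | none => simp; omega
        | some k => rfl }
  rw [Nat.card_congr (e.trans (Sym.equivNatSumOfFintype _ _).symm), Nat.card_eq_fintype_card,
    Sym.card_sym_eq_choose, Fintype.card_option, ZMod.card]
  congr 1
  omega

end CB

namespace CB

lemma exists_perm {N : ℕ} (r : Fin N → Fin N → Prop) (hirr : ∀ x, ¬ r x x)
    (htr : ∀ x y z, r x y → r y z → r x z) (htri : ∀ x y, x ≠ y → r x y ∨ r y x) :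
    ∃ σ : Equiv.Perm (Fin N), ∀ x y, σ x < σ y ↔ r x y := by
  classical
  let f : Fin N → Fin N := fun x => ⟨(Finset.univ.filter (fun y => r y x)).card, by
    calc _ < (Finset.univ : Finset (Fin N)).card := by
          apply Finset.card_lt_card
          rw [Finset.filter_ssubset]
          exact ⟨x, Finset.mem_univ x, hirr x⟩
      _ = N := by simp⟩
  have hmono : ∀ x y, r x y → f x < f y := by
    intro x y h
    change (Finset.univ.filter (fun z => r z x)).card < (Finset.univ.filter (fun z => r z y)).card
    apply Finset.card_lt_card
    rw [Finset.ssubset_iff_of_subset]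
    · exact ⟨x, by simpa using h, by simpa using hirr x⟩
    · intro z hz
      simp only [Finset.mem_filter, Finset.mem_univ, true_and] at hz ⊢
      exact htr _ _ _ hz h
  have hinj : Function.Injective f := by
    intro x y h
    by_contra hne
    rcases htri x y hne with h1 | h1
    · exact absurd h (hmono _ _ h1).ne
    · exact absurd h (hmono _ _ h1).ne'
  refine ⟨Equiv.ofBijective f (Finite.injective_iff_bijective.1 hinj), ?_⟩
  intro x y
  change f x < f y ↔ r x y
  refine ⟨fun h => ?_, hmono x y⟩
  have hne : x ≠ y := by rintro rfl; exact lt_irrefl _ h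
  rcases htri x y hne with h1 | h1
  · exact h1
  · exact absurd h (hmono _ _ h1).not_gt

lemma perm_ext_order {N : ℕ} (σ τ : Equiv.Perm (Fin N)) (h : ∀ x y, σ x < σ y ↔ τ x < τ y) : σ = τ := by
  let e : Fin N ≃o Fin N :=
    { toEquiv := σ.symm.trans τ
      map_rel_iff' := by
        intro x y
        have := h (σ.symm y) (σ.symm x)
        simp only [Equiv.apply_symm_apply] at this
        simp only [Equiv.trans_apply]
        rw [← not_lt, ← not_lt, this] }
  have he : e = OrderIso.refl _ := Subsingleton.elim _ _
  ext x
  have := DFunLike.congr_fun he (σ x)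
  have h2 : τ x = σ x := by simpa [e] using this
  rw [h2]

def wv {n d : ℕ} (w : ClosedWalk n d) (j : ZMod d) (t : ℕ) : ℕ :=
  if h : t < n + 1 then ((w.1 j).1 ⟨t, h⟩).val else 0

def aw {n d : ℕ} (w : ClosedWalk n d) (j : ZMod d) (t : ℕ) : Prop := wv w j 0 < wv w j t

lemma wv_inj {n d : ℕ} (w : ClosedWalk n d) (j : ZMod d) (s t : ℕ) (hs : s ≤ n) (ht : t ≤ n)
    (h : wv w j s = wv w j t) : s = t := by
  unfold wv at h
  rw [dif_pos (by omega), dif_pos (by omega)] at h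
  simpa using (w.1 j).1.injective (Fin.ext h)

lemma wv_step {n d : ℕ} (w : ClosedWalk n d) (j : ZMod d) (s t : ℕ) (hs : s + 1 ≤ n) (ht : t + 1 ≤ n) :
    wv w j (s + 1) < wv w j (t + 1) ↔ wv w (j + 1) s < wv w (j + 1) t := by
  have := w.2 j ⟨s, by omega⟩ ⟨t, by omega⟩
  unfold wv
  rw [dif_pos (by omega), dif_pos (by omega), dif_pos (by omega), dif_pos (by omega)]
  exact this

lemma wv_shift {n d : ℕ} (w : ClosedWalk n d) (s t u : ℕ) : ∀ (j : ZMod d), s + u ≤ n → t + u ≤ n →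
    (wv w j (s + u) < wv w j (t + u) ↔ wv w (j + (u : ZMod d)) s < wv w (j + (u : ZMod d)) t) := by
  induction u with
  | zero => intro j _ _; simp
  | succ u ih =>
    intro j hs ht
    rw [← add_assoc, ← add_assoc, wv_step w j _ _ (by omega) (by omega), ih _ (by omega) (by omega)]
    have : j + 1 + (u : ZMod d) = j + ((u + 1 : ℕ) : ZMod d) := by push_cast; ring
    rw [this]

lemma aw_valid {n d : ℕ} (w : ClosedWalk n d) : Valid n (aw w) := by
  constructor
  · intro j s u hs hu hsu h
    unfold aw at h ⊢
    rw [← wv_shift w 0 u s j (by omega) (by omega), zero_add, add_comm u s] at h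
    by_contra hc
    have hne : wv w j 0 ≠ wv w j (s + u) := fun h' => by
      have := wv_inj w j _ _ (by omega) (by omega) h'
      omega
    have hlt : wv w j (s + u) < wv w j 0 := by omega
    apply (w.1 j).2
    refine ⟨⟨0, by omega⟩, ⟨s, by omega⟩, ⟨s + u, by omega⟩, ?_, ?_, ?_, ?_⟩
    · exact Fin.mk_lt_mk.2 (by omega)
    · exact Fin.mk_lt_mk.2 (by omega)
    · unfold wv at h
      rw [dif_pos (by omega), dif_pos (by omega)] at h
      exact h
    · unfold wv at hlt
      rw [dif_pos (by omega), dif_pos (by omega)] at hlt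
      exact hlt
  · intro j s u hs hu hsu h1 h2
    unfold aw at *
    rw [← wv_shift w 0 u s j (by omega) (by omega), zero_add, add_comm u s] at h2
    omega

lemma aw_ext {n d : ℕ} (w w' : ClosedWalk n d) (h : ∀ j t, 1 ≤ t → t ≤ n → (aw w j t ↔ aw w' j t)) :
    w = w' := by
  have h1 : ∀ j s t, s < t → t ≤ n → (wv w j s < wv w j t ↔ wv w' j s < wv w' j t) := by
    intro j s t hst ht
    have e1 := wv_shift w 0 (t - s) s j (by omega) (by omega)
    have e2 := wv_shift w' 0 (t - s) s j (by omega) (by omega)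
    rw [zero_add, Nat.sub_add_cancel hst.le] at e1 e2
    rw [e1, e2]
    exact h _ (t - s) (by omega) (by omega)
  have h2 : ∀ j s t, s ≤ n → t ≤ n → (wv w j s < wv w j t ↔ wv w' j s < wv w' j t) := by
    intro j s t hs ht
    rcases lt_trichotomy s t with h3 | h3 | h3
    · exact h1 j s t h3 ht
    · subst h3; simp
    · have := h1 j t s h3 hs
      have n1 : wv w j s ≠ wv w j t := fun h' => by
        have := wv_inj w j _ _ hs ht h'
        omega
      have n2 : wv w' j s ≠ wv w' j t := fun h' => by
        have := wv_inj w' j _ _ hs ht h'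
        omega
      omega
  apply Subtype.ext
  funext j
  apply Subtype.ext
  apply perm_ext_order
  intro x y
  have := h2 j x y (by omega) (by omega)
  unfold wv at this
  rw [dif_pos (by omega), dif_pos (by omega), dif_pos (by omega), dif_pos (by omega)] at this
  exact this

lemma exists_walk {n d : ℕ} (a : ZMod d → ℕ → Prop) (ha : Valid n a) :
    ∃ w : ClosedWalk n d, ∀ j t, 1 ≤ t → t ≤ n → (aw w j t ↔ a j t) := by
  let B : ZMod d → ℕ → ℕ → Prop := fun j x y => a (j + (x : ZMod d)) (y - x)
  let r : ZMod d → ℕ → ℕ → Prop := fun j x y => (x < y ∧ B j x y) ∨ (y < x ∧ ¬ B j y x)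
  have hB1 : ∀ j x y z, x < y → y < z → z ≤ n → B j y z → B j x z := by
    intro j x y z hxy hyz hz h
    have := ha.h13 (j + (x : ZMod d)) (y - x) (z - y) (by omega) (by omega) (by omega)
    rw [show j + (x : ZMod d) + ((y - x : ℕ) : ZMod d) = j + y by
      rw [Nat.cast_sub hxy.le]; ring, show y - x + (z - y) = z - x by omega] at this
    exact this h
  have hB2 : ∀ j x y z, x < y → y < z → z ≤ n → ¬ B j x y → ¬ B j y z → ¬ B j x z := by
    intro j x y z hxy hyz hz h h'
    have := ha.h2 (j + (x : ZMod d)) (y - x) (z - y) (by omega) (by omega) (by omega)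
    rw [show j + (x : ZMod d) + ((y - x : ℕ) : ZMod d) = j + y by
      rw [Nat.cast_sub hxy.le]; ring, show y - x + (z - y) = z - x by omega] at this
    exact this h h'
  have hstep : ∀ j x y, r j (x + 1) (y + 1) ↔ r (j + 1) x y := by
    intro j x y
    have e1 : ∀ x y : ℕ, B j (x + 1) (y + 1) ↔ B (j + 1) x y := by
      intro x y
      simp only [B]
      rw [show j + ((x + 1 : ℕ) : ZMod d) = j + 1 + x by push_cast; ring,
        show y + 1 - (x + 1) = y - x by omega]
    simp only [r, e1, add_lt_add_iff_right]
  have hirr : ∀ j x, ¬ r j x x := by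
    intro j x h
    rcases h with h | h <;> exact lt_irrefl _ h.1
  have htri : ∀ j x y, x ≠ y → r j x y ∨ r j y x := by
    intro j x y hxy
    simp only [r]
    rcases lt_or_gt_of_ne hxy with h | h
    · by_cases hb : B j x y
      · exact Or.inl (Or.inl ⟨h, hb⟩)
      · exact Or.inr (Or.inr ⟨h, hb⟩)
    · by_cases hb : B j y x
      · exact Or.inr (Or.inl ⟨h, hb⟩)
      · exact Or.inl (Or.inr ⟨h, hb⟩)
  have htr : ∀ j x y z, x ≤ n → y ≤ n → z ≤ n → r j x y → r j y z → r j x z := by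
    intro j x y z hx hy hz h1 h2
    have f1 := hB1 j
    have f2 := hB2 j
    simp only [r] at h1 h2 ⊢
    rcases h1 with ⟨l1, h1⟩ | ⟨l1, h1⟩ <;> rcases h2 with ⟨l2, h2⟩ | ⟨l2, h2⟩
    · exact Or.inl ⟨by omega, f1 x y z l1 l2 hz h2⟩
    · rcases lt_trichotomy x z with l3 | l3 | l3
      · refine Or.inl ⟨l3, ?_⟩
        by_contra hc
        exact f2 x z y l3 l2 hy hc h2 h1
      · subst l3; exact absurd h1 h2
      · refine Or.inr ⟨l3, ?_⟩
        intro hc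
        exact h2 (f1 z x y l3 l1 hy h1)
    · rcases lt_trichotomy x z with l3 | l3 | l3
      · refine Or.inl ⟨l3, ?_⟩
        by_contra hc
        exact f2 y x z l1 l3 hz h1 hc h2
      · subst l3; exact absurd h2 h1
      · refine Or.inr ⟨l3, ?_⟩
        intro hc
        exact h1 (f1 y z x l2 l3 hx hc)
    · exact Or.inr ⟨by omega, f2 z y x l2 l1 hx h2 h1⟩
  have hσ : ∀ j, ∃ σ : Equiv.Perm (Fin (n + 1)), ∀ x y : Fin (n + 1), σ x < σ y ↔ r j x y := by
    intro j
    apply exists_perm (fun x y : Fin (n + 1) => r j x y)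
    · intro x; exact hirr j x
    · intro x y z; exact htr j x y z (by omega) (by omega) (by omega)
    · intro x y hxy; exact htri j x y (fun h => hxy (Fin.ext h))
  choose σ hσ using hσ
  refine ⟨⟨fun j => ⟨σ j, ?_⟩, ?_⟩, ?_⟩
  · rintro ⟨x, y, z, hxy, hyz, h1, h2⟩
    rw [hσ] at h1 h2
    rcases h1 with ⟨l1, h1⟩ | ⟨l1, h1⟩
    · rcases h2 with ⟨l2, h2⟩ | ⟨l2, h2⟩
      · have : (x : ℕ) < y := hxy
        omega
      · exact h2 (hB1 j x y z hxy hyz (by omega) h1)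
    · have : (y : ℕ) < z := hyz
      omega
  · intro j x y
    change σ j x.succ < σ j y.succ ↔ σ (j + 1) x.castSucc < σ (j + 1) y.castSucc
    rw [hσ, hσ]
    simpa using hstep j x y
  · intro j t ht htn
    unfold aw wv
    rw [dif_pos (by omega), dif_pos (by omega)]
    change σ j _ < σ j _ ↔ _
    rw [hσ]
    simp only [r, B]
    constructor
    · rintro (⟨_, h⟩ | ⟨h, _⟩)
      · simpa using h
      · omega
    · intro h
      exact Or.inl ⟨ht, by simpa using h⟩

lemma card_walk {n d : ℕ} (hd : 1 ≤ d) (hdn : d ≤ n) : Nat.card (ClosedWalk n d) = (2 * d).choose d := by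
  haveI : NeZero d := ⟨by omega⟩
  rw [← card_c d]
  have congrC : ∀ a a' : ZMod d → ℕ → Prop, (∀ j t, 1 ≤ t → t ≤ n → (a j t ↔ a' j t)) →
      cOf n a = cOf n a' := by
    classical
    intro a a' h
    funext k
    unfold cOf
    congr 1
    apply Finset.filter_congr
    intro u hu
    rw [Finset.mem_Icc] at hu
    unfold Q
    rw [h _ u hu.1 hu.2]
    refine and_congr_right fun _ => and_congr_right fun _ => ?_
    refine forall_congr' fun s => forall_congr' fun h1 => forall_congr' fun h2 => ?_
    exact h _ s h1 (by omega)
  apply Nat.card_eq_of_bijective (fun w => ⟨cOf n (aw w), sum_cOf_le n (aw w)⟩)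
  constructor
  · intro w w' h
    have h' : cOf n (aw w) = cOf n (aw w') := congrArg Subtype.val h
    apply aw_ext
    intro j t ht htn
    rw [a_iff _ (aw_valid w) j t ht htn, a_iff _ (aw_valid w') j t ht htn, h']
  · rintro ⟨c, hc⟩
    obtain ⟨w, hw⟩ := exists_walk (n := n) (AF c) (AF_valid n c)
    refine ⟨w, Subtype.ext ?_⟩
    change cOf n (aw w) = c
    rw [congrC _ _ hw, cOf_AF hdn c hc]

/-! Cycle counting -/

instance {n : ℕ} : Finite (Edge n) := by unfold Edge; infer_instance

instance {n d : ℕ} [NeZero d] : Finite (ClosedWalk n d) := by unfold ClosedWalk; infer_instance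

def shiftW {n d : ℕ} (c : ZMod d) (w : ClosedWalk n d) : ClosedWalk n d :=
  ⟨fun i => w.1 (i + c), fun i => by
    have := w.2 (i + c)
    rwa [show i + c + 1 = i + 1 + c by ring] at this⟩

lemma shiftW_shiftW {n d : ℕ} (c c' : ZMod d) (w : ClosedWalk n d) :
    shiftW c (shiftW c' w) = shiftW (c + c') w := by
  apply Subtype.ext; funext i
  change w.1 (i + c + c') = w.1 (i + (c + c'))
  rw [add_assoc]

lemma shiftW_zero {n d : ℕ} (w : ClosedWalk n d) : shiftW 0 w = w := by
  apply Subtype.ext; funext i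
  change w.1 (i + 0) = w.1 i
  rw [add_zero]

lemma walkClass_eq {n d : ℕ} (w : ClosedWalk n d) : walkClass w = Set.range (fun c => shiftW c w) := by
  ext w'
  constructor
  · rintro ⟨c, h⟩
    exact ⟨c, Subtype.ext (funext fun i => (h i).symm)⟩
  · rintro ⟨c, rfl⟩
    exact ⟨c, fun i => rfl⟩

lemma walkClass_eq_iff {n d : ℕ} (w w' : ClosedWalk n d) : walkClass w' = walkClass w ↔ w' ∈ walkClass w := by
  constructor
  · intro h
    rw [← h, walkClass_eq]
    exact ⟨0, shiftW_zero _⟩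
  · intro h
    rw [walkClass_eq] at h
    obtain ⟨c, rfl⟩ := h
    dsimp only
    ext v
    rw [walkClass_eq, walkClass_eq]
    constructor
    · rintro ⟨c', rfl⟩
      exact ⟨c' + c, (shiftW_shiftW _ _ _).symm⟩
    · rintro ⟨c', rfl⟩
      refine ⟨c' - c, ?_⟩
      dsimp only
      rw [shiftW_shiftW, sub_add_cancel]

lemma mul_numCycles (n e : ℕ) [NeZero e] :
    e * numCycles n e = Nat.card {w : ClosedWalk n e // (walkClass w).ncard = e} := by
  have eqv : {w : ClosedWalk n e // (walkClass w).ncard = e} ≃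
    Σ S : {S : Set (ClosedWalk n e) // (∃ w : ClosedWalk n e, S = walkClass w) ∧ S.ncard = e}, S.1 :=
    { toFun := fun w => ⟨⟨walkClass w.1, ⟨w.1, rfl⟩, w.2⟩, ⟨w.1, (walkClass_eq_iff _ _).1 rfl⟩⟩
      invFun := fun p => ⟨p.2.1, by
        obtain ⟨⟨S, ⟨w, rfl⟩, hS⟩, v, hv⟩ := p
        dsimp only
        rw [(walkClass_eq_iff _ _).2 hv, hS]⟩
      left_inv := fun w => rfl
      right_inv := fun p => by
        obtain ⟨⟨S, ⟨w, rfl⟩, hS⟩, v, hv⟩ := p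
        have := (walkClass_eq_iff _ _).2 hv
        dsimp only at this ⊢
        refine Sigma.subtype_ext (Subtype.ext this) rfl }
  haveI : Fintype {S : Set (ClosedWalk n e) // (∃ w : ClosedWalk n e, S = walkClass w) ∧ S.ncard = e} :=
    Fintype.ofFinite _
  rw [Nat.card_congr eqv, Nat.card_sigma]
  have : ∀ S : {S : Set (ClosedWalk n e) // (∃ w : ClosedWalk n e, S = walkClass w) ∧ S.ncard = e},
      Nat.card S.1 = e := fun S => S.2.2
  simp only [this, Finset.sum_const, smul_eq_mul, numCycles, Nat.card_eq_fintype_card, Finset.card_univ]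
  ring

def T {α : Type} (f : ℕ → α) : ℕ → α := fun i => f (i + 1)

lemma T_iter {α : Type} (f : ℕ → α) (m : ℕ) : T^[m] f = fun i => f (i + m) := by
  induction m generalizing f with
  | zero => rfl
  | succ m ih =>
    rw [Function.iterate_succ_apply, ih]
    funext i
    simp [T, add_assoc]

def lft {n d : ℕ} (w : ClosedWalk n d) : ℕ → Edge n := fun i => w.1 (i : ZMod d)

lemma lft_inj {n d : ℕ} [NeZero d] : Function.Injective (lft : ClosedWalk n d → ℕ → Edge n) := by
  intro w w' h
  apply Subtype.ext; funext i
  have := congrFun h i.val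
  simpa [lft] using this

lemma lft_surj {n d : ℕ} [NeZero d] (f : ℕ → Edge n) (hf : ∀ i, HeadEqTail (f i) (f (i + 1)))
    (hp : Function.IsPeriodicPt T d f) : ∃ w : ClosedWalk n d, lft w = f := by
  have hper : Function.Periodic f d := by
    intro i
    have h : T^[d] f = f := hp
    rw [T_iter] at h
    exact congrFun h i
  have hv : ∀ i : ℕ, f (i : ZMod d).val = f i := by
    intro i
    rw [ZMod.val_natCast]
    exact hper.map_mod_nat i
  refine ⟨⟨fun z => f z.val, fun z => ?_⟩, ?_⟩
  · have h1 := hf z.val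
    have h2 := hv (z.val + 1)
    have h3 : ((z.val + 1 : ℕ) : ZMod d) = z + 1 := by simp
    rw [h3] at h2
    dsimp only
    rwa [h2]
  · funext i
    exact hv i

lemma lft_walk {n d : ℕ} (w : ClosedWalk n d) (i : ℕ) : HeadEqTail (lft w i) (lft w (i + 1)) := by
  have := w.2 (i : ZMod d)
  unfold lft
  push_cast
  exact this

lemma lft_shift {n d : ℕ} (w : ClosedWalk n d) (m : ℕ) : lft (shiftW (m : ZMod d) w) = T^[m] (lft w) := by
  rw [T_iter]
  funext i
  unfold lft shiftW
  simp

lemma lft_per {n d : ℕ} (w : ClosedWalk n d) : Function.IsPeriodicPt T d (lft w) := by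
  change T^[d] (lft w) = lft w
  rw [← lft_shift, ZMod.natCast_self, shiftW_zero]

lemma prim_iff {n e : ℕ} [NeZero e] (w : ClosedWalk n e) :
    (walkClass w).ncard = e ↔ Function.minimalPeriod T (lft w) = e := by
  have h1 : (walkClass w).ncard = e ↔ Function.Injective (fun c => shiftW c w) := by
    rw [walkClass_eq, ← Set.image_univ]
    conv_lhs => rhs; rw [← ZMod.card e, ← Nat.card_eq_fintype_card, ← Set.ncard_univ]
    rw [Set.ncard_image_iff Set.finite_univ, Set.injOn_univ]
  rw [h1]
  have hdvd := (lft_per w).minimalPeriod_dvd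
  have hpos := (lft_per w).minimalPeriod_pos (NeZero.pos e)
  have hle := Nat.le_of_dvd (NeZero.pos e) hdvd
  constructor
  · intro hinj
    by_contra hne
    have hlt : Function.minimalPeriod T (lft w) < e := lt_of_le_of_ne hle hne
    have h2 : shiftW ((Function.minimalPeriod T (lft w) : ℕ) : ZMod e) w = shiftW 0 w := by
      rw [shiftW_zero]
      apply lft_inj
      rw [lft_shift]
      exact Function.iterate_minimalPeriod
    have h3 := congrArg ZMod.val (hinj h2)
    rw [ZMod.val_natCast_of_lt hlt, ZMod.val_zero] at h3
    omega
  · intro hm c c' h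
    dsimp only at h
    have h2 : shiftW (c - c') w = w := by
      have h3 := congrArg (shiftW (-c')) h
      rw [shiftW_shiftW, shiftW_shiftW, neg_add_cancel, shiftW_zero] at h3
      rw [sub_eq_neg_add]; exact h3
    have h4 : Function.IsPeriodicPt T (c - c').val (lft w) := by
      change T^[_] _ = _
      rw [← lft_shift]
      simp [h2]
    have h5 := h4.minimalPeriod_dvd
    rw [hm] at h5
    have h6 := Nat.eq_zero_of_dvd_of_lt h5 (ZMod.val_lt _)
    rw [ZMod.val_eq_zero] at h6
    exact sub_eq_zero.1 h6

lemma card_min {n e d : ℕ} [NeZero d] (hed : e ∣ d) :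
    Nat.card {w : ClosedWalk n d // Function.minimalPeriod T (lft w) = e} =
    Nat.card {f : ℕ → Edge n // (∀ i, HeadEqTail (f i) (f (i + 1))) ∧ Function.minimalPeriod T f = e} := by
  apply Nat.card_eq_of_bijective (fun w => ⟨lft w.1, lft_walk w.1, w.2⟩)
  constructor
  · intro w w' h
    exact Subtype.ext (lft_inj (congrArg Subtype.val h))
  · rintro ⟨f, hf, hm⟩
    obtain ⟨w, rfl⟩ := lft_surj (d := d) f hf (by
      rw [Function.isPeriodicPt_iff_minimalPeriod_dvd, hm]; exact hed)
    exact ⟨⟨w, hm⟩, rfl⟩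

end CB

/-- For `1 ≤ d ≤ n`, `binomial (2d) d = Σ_{e ∣ d} e · h(e)`, where `h(e)` is the number
of `e`-cycles in `G(n, 312)` and the sum is over the positive divisors `e` of `d`. -/
theorem central_binomial_eq_sum_cycles (n d : ℕ) (hd : 1 ≤ d) (hdn : d ≤ n) :
    (2 * d).choose d = ∑ e ∈ d.divisors, e * numCycles n e := by
  classical
  haveI : NeZero d := ⟨by omega⟩
  rw [← CB.card_walk hd hdn]
  haveI : Fintype (ClosedWalk n d) := Fintype.ofFinite _
  rw [Nat.card_eq_fintype_card, ← Finset.card_univ,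
    Finset.card_eq_sum_card_fiberwise (f := fun w : ClosedWalk n d => Function.minimalPeriod CB.T (CB.lft w))
      (t := d.divisors) (fun w _ => by
        simpa using ⟨(CB.lft_per w).minimalPeriod_dvd, by omega⟩)]
  apply Finset.sum_congr rfl
  intro e he
  have hed := Nat.dvd_of_mem_divisors he
  haveI : NeZero e := ⟨(Nat.pos_of_mem_divisors he).ne'⟩
  rw [CB.mul_numCycles, Nat.card_congr (Equiv.subtypeEquivRight fun w => CB.prim_iff w),
    CB.card_min (dvd_refl e), ← CB.card_min (n := n) hed, Nat.card_eq_fintype_card, Fintype.card_subtype]
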